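/- Let S³ = {x ∈ ℝ⁴ : |x| = 1} carry its surface (Riemannian volume) measure, and for P ∈ S³ and t > 0 let δ_{P,t}(x) = t / (1 + ((t²−1)/2)(1 − ⟨x,P⟩)), where ⟨·,·⟩ is the Euclidean inner product of ℝ⁴. Then for every P ∈ S³ and every t > 0, ∫_{S³} δ_{P,t}(x)³ dx = 2π², i.e., the integral of the cube of any standard bubble equals the total surface measure |S³| of S³. -/

import Mathlib

open MeasureTheory Real Set Metric
open scoped RealInnerProductSpace

noncomputable section

/-- The unit sphere `S³ ⊂ ℝ⁴`. -/
abbrev S3 : Set (EuclideanSpace ℝ (Fin 4)) := Metric.sphere (0 : EuclideanSpace ℝ (Fin 4)) 1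

/-- The surface (Riemannian volume) measure on `S³`, realized as the measure on the unit
sphere induced by the Lebesgue measure of `ℝ⁴` (so that the total mass is `2π²`). -/
def μS3 : Measure S3 := (volume : Measure (EuclideanSpace ℝ (Fin 4))).toSphere

/-- The standard bubble `δ_{P,t}(x) = t / (1 + ((t²−1)/2)(1 − ⟨x,P⟩))` on `S³`. -/
def bubble (P : S3) (t : ℝ) (x : S3) : ℝ :=
  t / (1 + ((t ^ 2 - 1) / 2) *
    (1 - ⟪(x : EuclideanSpace ℝ (Fin 4)), (P : EuclideanSpace ℝ (Fin 4))⟫))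

/-- The geodesic distance on the unit sphere: `d(P,Q) = arccos ⟨P,Q⟩`. -/
def geoDist (P Q : S3) : ℝ :=
  Real.arccos ⟪(P : EuclideanSpace ℝ (Fin 4)), (Q : EuclideanSpace ℝ (Fin 4))⟫

/-- The Green's function `G_P(Q) = 1/(1 − ⟨P,Q⟩) = 1/(1 − cos d(P,Q))`. -/
def green (P Q : S3) : ℝ :=
  1 / (1 - ⟪(P : EuclideanSpace ℝ (Fin 4)), (Q : EuclideanSpace ℝ (Fin 4))⟫)

/-- Integration in polar coordinates in a finite-dimensional normed space. -/
theorem lintegral_eq_lintegral_toSphere {E : Type*} [NormedAddCommGroup E] [NormedSpace ℝ E]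
    [FiniteDimensional ℝ E] [Nontrivial E] [MeasurableSpace E] [BorelSpace E]
    (μ : Measure E) [μ.IsAddHaarMeasure] {f : E → ENNReal} (hf : Measurable f) :
    ∫⁻ x, f x ∂μ = ∫⁻ s : sphere (0 : E) 1, (∫⁻ r in Ioi (0 : ℝ),
      ENNReal.ofReal (r ^ (Module.finrank ℝ E - 1)) * f (r • (s : E))) ∂μ.toSphere := by
  have hm : Measurable fun p : sphere (0 : E) 1 × Ioi (0 : ℝ) ↦ f ((p.2 : ℝ) • (p.1 : E)) := by
    fun_prop
  calc
    ∫⁻ x, f x ∂μ = ∫⁻ x : ({(0)}ᶜ : Set E), f x.1 ∂(μ.comap (↑)) := by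
      rw [lintegral_subtype_comap (measurableSet_singleton _).compl f,
        restrict_compl_singleton]
    _ = ∫⁻ p, f ((p.2 : ℝ) • (p.1 : E))
          ∂μ.toSphere.prod (.volumeIoiPow (Module.finrank ℝ E - 1)) := by
      rw [← μ.measurePreserving_homeomorphUnitSphereProd.lintegral_comp_emb
        (Homeomorph.measurableEmbedding _)]
      refine lintegral_congr fun x ↦ ?_
      have hx : ‖(x : E)‖ ≠ 0 := norm_ne_zero_iff.2 x.2
      simp [smul_smul, hx]
    _ = ∫⁻ s, ∫⁻ r, f ((r : ℝ) • (s : E)) ∂.volumeIoiPow (Module.finrank ℝ E - 1)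
          ∂μ.toSphere := lintegral_prod _ hm.aemeasurable
    _ = _ := by
      refine lintegral_congr fun s ↦ ?_
      have hs : Measurable fun r : Ioi (0 : ℝ) ↦ f ((r : ℝ) • (s : E)) := by fun_prop
      rw [Measure.volumeIoiPow, lintegral_withDensity_eq_lintegral_mul _ (by fun_prop) hs,
        ← lintegral_subtype_comap measurableSet_Ioi]
      rfl

theorem toSphere_fin_three_univ :
    (volume : Measure (EuclideanSpace ℝ (Fin 3))).toSphere univ = ENNReal.ofReal (4 * π) := by
  rw [Measure.toSphere_apply_univ, EuclideanSpace.volume_ball_fin_three, finrank_euclideanSpace,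
    Fintype.card_fin, ← ENNReal.ofReal_natCast, ENNReal.ofReal_one, one_pow, one_mul,
    ← ENNReal.ofReal_mul (by positivity)]
  congr 1
  push_cast
  ring

theorem lintegral_norm_fin_three {f : ℝ → ENNReal} (hf : Measurable f) :
    ∫⁻ y : EuclideanSpace ℝ (Fin 3), f ‖y‖ =
      ENNReal.ofReal (4 * π) * ∫⁻ r in Ioi (0 : ℝ), ENNReal.ofReal (r ^ 2) * f r := by
  rw [lintegral_eq_lintegral_toSphere _ (by fun_prop)]
  have (s : sphere (0 : EuclideanSpace ℝ (Fin 3)) 1) :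
      ∫⁻ r in Ioi (0 : ℝ), ENNReal.ofReal
        (r ^ (Module.finrank ℝ (EuclideanSpace ℝ (Fin 3)) - 1)) *
          f ‖r • (s : EuclideanSpace ℝ (Fin 3))‖ =
      ∫⁻ r in Ioi (0 : ℝ), ENNReal.ofReal (r ^ 2) * f r := by
    refine setLIntegral_congr_fun measurableSet_Ioi fun r hr ↦ ?_
    simp [norm_smul, abs_of_pos (mem_Ioi.1 hr)]
  simp_rw [this]
  rw [lintegral_const, toSphere_fin_three_univ, mul_comm]

/-- Integration over `ℝ⁴` split along the line spanned by a unit vector. -/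
theorem lintegral_norm_inner (P : S3) {F : ℝ → ℝ → ENNReal}
    (hF : Measurable fun p : ℝ × ℝ ↦ F p.1 p.2) :
    ∫⁻ x : EuclideanSpace ℝ (Fin 4), F ‖x‖ ⟪x, (P : EuclideanSpace ℝ (Fin 4))⟫ =
      ∫⁻ a : ℝ, ∫⁻ y : EuclideanSpace ℝ (Fin 3), F √(a ^ 2 + ‖y‖ ^ 2) a := by
  obtain ⟨b, hb⟩ := Orthonormal.exists_orthonormalBasis_extension_of_card_eq
    (𝕜 := ℝ) (ι := Fin 4) (by simp) (v := fun _ ↦ (P : EuclideanSpace ℝ (Fin 4))) (s := {0})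
    ⟨by simp, fun i j hij ↦ (hij (Subsingleton.elim _ _)).elim⟩
  have hb0 : b 0 = P := hb 0 rfl
  have hrepr (x : EuclideanSpace ℝ (Fin 4)) :
      F ‖x‖ ⟪x, (P : EuclideanSpace ℝ (Fin 4))⟫ = F ‖b.repr x‖ (b.repr x 0) := by
    rw [b.repr.norm_map, b.repr_apply_apply, hb0, real_inner_comm]
  have hm : Measurable fun p : ℝ × (Fin 3 → ℝ) ↦
      F √(p.1 ^ 2 + ‖WithLp.toLp 2 p.2‖ ^ 2) p.1 := by
    have : Measurable fun p : ℝ × (Fin 3 → ℝ) ↦ (√(p.1 ^ 2 + ‖WithLp.toLp 2 p.2‖ ^ 2), p.1) := by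
      fun_prop
    exact hF.comp this
  simp_rw [hrepr]
  rw [b.measurePreserving_repr.lintegral_comp
      (f := fun x : EuclideanSpace ℝ (Fin 4) ↦ F ‖x‖ (x 0))
      (hF.comp (by fun_prop : Measurable fun x : EuclideanSpace ℝ (Fin 4) ↦ (‖x‖, x 0)))]
  have hsplit (x : EuclideanSpace ℝ (Fin 4)) : F ‖x‖ (x 0) =
      (fun p : ℝ × (Fin 3 → ℝ) ↦ F √(p.1 ^ 2 + ‖WithLp.toLp 2 p.2‖ ^ 2) p.1)
        (MeasurableEquiv.piFinSuccAbove (fun _ ↦ ℝ) 0 (WithLp.ofLp x)) := by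
    change F ‖x‖ (x 0) = F √(x 0 ^ 2 + ‖WithLp.toLp 2 (fun i ↦ x (Fin.succAbove 0 i))‖ ^ 2) (x 0)
    congr 1
    rw [EuclideanSpace.norm_eq, EuclideanSpace.norm_sq_eq, Fin.sum_univ_succ]
    simp
  simp_rw [hsplit]
  refine (((volume_preserving_piFinSuccAbove (fun _ : Fin 4 ↦ ℝ) 0).comp
    (PiLp.volume_preserving_ofLp (Fin 4))).lintegral_comp hm).trans ?_
  rw [Measure.volume_eq_prod,
    lintegral_prod _ hm.aemeasurable]
  refine lintegral_congr fun a ↦ ?_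
  exact ((PiLp.volume_preserving_ofLp (Fin 3)).lintegral_comp
    (hm.comp measurable_prodMk_left)).symm

/-- Polar coordinates in the upper half-plane. -/
theorem lintegral_upperHalfPlane_polar {G : ℝ × ℝ → ENNReal} (hG : Measurable G) :
    ∫⁻ a : ℝ, ∫⁻ r in Ioi (0 : ℝ), G (a, r) =
      ∫⁻ ρ in Ioi (0 : ℝ), ∫⁻ θ in Ioo 0 π,
        ENNReal.ofReal ρ * G (ρ * cos θ, ρ * sin θ) := by
  have hs : MeasurableSet {p : ℝ × ℝ | 0 < p.2} := measurableSet_lt (by fun_prop) (by fun_prop)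
  have hind : Measurable ({p : ℝ × ℝ | 0 < p.2}.indicator G) := hG.indicator hs
  calc
    _ = ∫⁻ p : ℝ × ℝ, {p : ℝ × ℝ | 0 < p.2}.indicator G p := by
      rw [Measure.volume_eq_prod, lintegral_prod _ hind.aemeasurable]
      refine lintegral_congr fun a ↦ ?_
      rw [← lintegral_indicator measurableSet_Ioi]
      rfl
    _ = _ := by
      have hm : Measurable fun p : ℝ × ℝ ↦ ENNReal.ofReal p.1 •
          {p : ℝ × ℝ | 0 < p.2}.indicator G (polarCoord.symm p) := by
        simp only [polarCoord_symm_apply, smul_eq_mul]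
        exact (by fun_prop : Measurable fun p : ℝ × ℝ ↦ ENNReal.ofReal p.1).mul
          (hind.comp (by fun_prop))
      rw [← lintegral_comp_polarCoord_symm, polarCoord_target, Measure.volume_eq_prod,
        setLIntegral_prod _ hm.aemeasurable]
      refine setLIntegral_congr_fun measurableSet_Ioi fun ρ hρ ↦ ?_
      rw [mem_Ioi] at hρ
      simp only
      rw [← lintegral_indicator measurableSet_Ioo, ← lintegral_indicator measurableSet_Ioo]
      refine lintegral_congr fun θ ↦ ?_
      by_cases h : θ ∈ Ioo 0 π
      · have h' : θ ∈ Ioo (-π) π := ⟨by linarith [h.1, pi_pos], h.2⟩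
        have : 0 < ρ * sin θ := mul_pos hρ (sin_pos_of_mem_Ioo h)
        simp [h, h', this]
      · by_cases h' : θ ∈ Ioo (-π) π
        · have hθ : θ ≤ 0 := not_lt.1 fun h0 ↦ h ⟨h0, h'.2⟩
          have : ρ * sin θ ≤ 0 := mul_nonpos_of_nonneg_of_nonpos hρ.le
            (sin_nonpos_of_nonpos_of_neg_pi_le hθ h'.1.le)
          simp [h, h', this]
        · simp [h, h']

/-- Integration of a zonal function on `S³`. -/
theorem lintegral_inner_μS3 (P : S3) {f : ℝ → ENNReal} (hf : Measurable f) :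
    ∫⁻ x : S3, f ⟪(x : EuclideanSpace ℝ (Fin 4)), (P : EuclideanSpace ℝ (Fin 4))⟫ ∂μS3 =
      ENNReal.ofReal (4 * π) * ∫⁻ θ in Ioo 0 π, ENNReal.ofReal (sin θ ^ 2) * f (cos θ) := by
  set g : ℝ → ENNReal := (Iio (1 : ℝ)).indicator 1 with hg
  have hgm : Measurable g := measurable_one.indicator measurableSet_Iio
  set K : ENNReal := ∫⁻ r in Ioi (0 : ℝ), ENNReal.ofReal (r ^ 3) * g r with hK
  have hKval : K = ENNReal.ofReal (1 / 4) := by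
    have hfun (r : ℝ) : ENNReal.ofReal (r ^ 3) * g r =
        (Iio (1 : ℝ)).indicator (fun r ↦ ENNReal.ofReal (r ^ 3)) r := by
      by_cases h : r ∈ Iio (1 : ℝ) <;> simp only [hg, h, indicator_of_mem, indicator_of_notMem,
        not_false_eq_true, Pi.one_apply, mul_one, mul_zero]
    simp_rw [hK, hfun]
    rw [setLIntegral_indicator measurableSet_Iio, Iio_inter_Ioi,
      Measure.restrict_congr_set Ioo_ae_eq_Ioc,
      ← ofReal_integral_eq_lintegral_ofReal (intervalIntegral.intervalIntegrable_pow _).1,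
      ← intervalIntegral.integral_of_le zero_le_one, integral_pow]
    · norm_num
    · filter_upwards [ae_restrict_mem measurableSet_Ioc] with y hy
      exact pow_nonneg hy.1.le _
  have hK0 : K ≠ 0 := by rw [hKval]; simp
  have hKtop : K ≠ ⊤ := by rw [hKval]; simp
  have hF : Measurable fun p : ℝ × ℝ ↦ g p.1 * f (p.2 / p.1) := by fun_prop
  have hsphere : ∫⁻ x : EuclideanSpace ℝ (Fin 4),
      g ‖x‖ * f (⟪x, (P : EuclideanSpace ℝ (Fin 4))⟫ / ‖x‖) =
      (∫⁻ x : S3, f ⟪(x : EuclideanSpace ℝ (Fin 4)), (P : EuclideanSpace ℝ (Fin 4))⟫ ∂μS3)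
        * K := by
    rw [lintegral_eq_lintegral_toSphere _ (by fun_prop), ← lintegral_mul_const' _ _ hKtop, μS3]
    refine lintegral_congr fun s ↦ ?_
    rw [hK, ← lintegral_const_mul _ (by fun_prop)]
    refine setLIntegral_congr_fun measurableSet_Ioi fun r hr ↦ ?_
    rw [mem_Ioi] at hr
    simp only [finrank_euclideanSpace, Fintype.card_fin, norm_smul, norm_eq_abs, abs_of_pos hr,
      norm_eq_of_mem_sphere, mul_one, real_inner_smul_left, mul_div_cancel_left₀ _ hr.ne']
    ring
  have hcyl : ∫⁻ x : EuclideanSpace ℝ (Fin 4),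
      g ‖x‖ * f (⟪x, (P : EuclideanSpace ℝ (Fin 4))⟫ / ‖x‖) =
      (ENNReal.ofReal (4 * π) * ∫⁻ θ in Ioo 0 π, ENNReal.ofReal (sin θ ^ 2) * f (cos θ))
        * K := by
    rw [lintegral_norm_inner P (F := fun ρ a ↦ g ρ * f (a / ρ)) hF]
    have hthree (a : ℝ) := lintegral_norm_fin_three
      (f := fun r ↦ g √(a ^ 2 + r ^ 2) * f (a / √(a ^ 2 + r ^ 2))) (by fun_prop)
    simp_rw [hthree]
    rw [lintegral_const_mul' _ _ ENNReal.ofReal_ne_top, mul_assoc]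
    congr 1
    rw [lintegral_upperHalfPlane_polar (G := fun p ↦ ENNReal.ofReal (p.2 ^ 2) *
        (g √(p.1 ^ 2 + p.2 ^ 2) * f (p.1 / √(p.1 ^ 2 + p.2 ^ 2)))) (by fun_prop),
      hK, ← lintegral_const_mul _ (by fun_prop)]
    refine setLIntegral_congr_fun measurableSet_Ioi fun ρ hρ ↦ ?_
    rw [mem_Ioi] at hρ
    simp only
    rw [← lintegral_mul_const _ (by fun_prop)]
    refine setLIntegral_congr_fun measurableSet_Ioo fun θ _ ↦ ?_
    have hnorm : √((ρ * cos θ) ^ 2 + (ρ * sin θ) ^ 2) = ρ := by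
      rw [show (ρ * cos θ) ^ 2 + (ρ * sin θ) ^ 2 = ρ ^ 2 by
        linear_combination ρ ^ 2 * sin_sq_add_cos_sq θ, sqrt_sq hρ.le]
    simp only [hnorm, mul_div_cancel_left₀ _ hρ.ne']
    rw [mul_pow, ENNReal.ofReal_mul (by positivity), pow_succ ρ 2,
      ENNReal.ofReal_mul (by positivity)]
    ring
  exact (ENNReal.mul_left_inj hK0 hKtop).1 (hsphere.symm.trans hcyl)

theorem bubble_denom_pos {t : ℝ} (ht : 0 < t) {c : ℝ} (hc : c ∈ Icc (-1) 1) :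
    0 < 1 + ((t ^ 2 - 1) / 2) * (1 - c) := by
  have h2 : 0 < t ^ 2 := by positivity
  rcases eq_or_lt_of_le hc.1 with h | h
  · rw [← h]; linarith
  · nlinarith [mul_nonneg h2.le (sub_nonneg.2 hc.2)]

theorem integral_sin_sq_mul_bubble_cube {t : ℝ} (ht : 0 < t) :
    ∫ θ in (0)..π, sin θ ^ 2 * (t / (1 + ((t ^ 2 - 1) / 2) * (1 - cos θ))) ^ 3 = π / 2 := by
  set D : ℝ → ℝ := fun θ ↦ 1 + ((t ^ 2 - 1) / 2) * (1 - cos θ) with hD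
  have hDpos (θ : ℝ) : 0 < D θ := bubble_denom_pos ht ⟨neg_one_le_cos θ, cos_le_one θ⟩
  have hDc : Continuous D := by fun_prop
  set u : ℝ → ℝ := fun θ ↦ ((1 + cos θ) - t ^ 2 * (1 - cos θ)) / (2 * D θ) with hu
  set w : ℝ → ℝ := fun θ ↦ t * sin θ / D θ with hw
  have huw (θ : ℝ) : 1 - u θ ^ 2 = w θ ^ 2 := by
    have h0 := (hDpos θ).ne'
    have h1 := sin_sq θ
    simp only [hu, hw]
    field_simp
    rw [h1]
    simp only [hD]
    ring
  have hDd (θ : ℝ) : HasDerivAt D ((t ^ 2 - 1) / 2 * sin θ) θ := by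
    convert! (((hasDerivAt_cos θ).const_sub 1).const_mul ((t ^ 2 - 1) / 2)).const_add 1 using 1
    ring
  have hud (θ : ℝ) : HasDerivAt u (-(w θ * (t / D θ))) θ := by
    have h0 := (hDpos θ).ne'
    convert! (((hasDerivAt_cos θ).const_add 1).sub
      (((hasDerivAt_cos θ).const_sub 1).const_mul (t ^ 2))).div ((hDd θ).const_mul 2)
      (by positivity) using 1
    simp only [hw, Pi.sub_apply]
    field_simp
    simp only [hD]
    ring
  have hwd (θ : ℝ) : HasDerivAt w (u θ * (t / D θ)) θ := by
    have h0 := (hDpos θ).ne'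
    have h1 := sin_sq θ
    convert! ((hasDerivAt_sin θ).const_mul t).div (hDd θ) h0 using 1
    simp only [hu]
    field_simp
    rw [h1]
    simp only [hD]
    ring
  have huc : Continuous u := continuous_iff_continuousAt.2 fun θ ↦ (hud θ).continuousAt
  have hwc : Continuous w := continuous_iff_continuousAt.2 fun θ ↦ (hwd θ).continuousAt
  have hint : Continuous fun θ ↦ sin θ ^ 2 * (t / D θ) ^ 3 := by
    have := fun θ ↦ (hDpos θ).ne'
    fun_prop (disch := assumption)
  rw [intervalIntegral.integral_eq_sub_of_hasDerivAt_of_le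
    (f := fun θ ↦ (arccos (u θ) - u θ * w θ) / 2) pi_pos.le
    ((continuous_arccos.comp huc).sub (huc.mul hwc) |>.div_const 2).continuousOn ?_
    (hint.intervalIntegrable _ _)]
  · have h0 : u 0 = 1 := by simp [hu, hD]
    have h1 : u π = -1 := by
      have := (hDpos π).ne'
      simp only [hu]
      rw [div_eq_iff (by positivity)]
      simp only [hD, cos_pi]
      ring
    simp [h0, h1, hw]
  · intro θ hθ
    have hwpos : 0 < w θ := div_pos (mul_pos ht (sin_pos_of_mem_Ioo hθ)) (hDpos θ)
    have hsqrt : √(1 - u θ ^ 2) = w θ := by rw [huw, sqrt_sq hwpos.le]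
    have hne1 : u θ ≠ -1 := fun h ↦ by have := huw θ; rw [h] at this; nlinarith
    have hne2 : u θ ≠ 1 := fun h ↦ by have := huw θ; rw [h] at this; nlinarith
    convert! ((((hasDerivAt_arccos hne1 hne2).comp θ (hud θ)).sub
      ((hud θ).mul (hwd θ))).div_const 2) using 1
    have hw2 : sin θ ^ 2 * (t / D θ) ^ 3 = w θ ^ 2 * (t / D θ) := by simp only [hw]; ring
    rw [hsqrt, hw2]
    have h := huw θ
    generalize t / D θ = k
    generalize w θ = b at *
    generalize u θ = a at *
    field_simp
    linear_combination (-k) * h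

/-- The integral of the cube of any standard bubble over `S³` equals the total
surface measure `|S³| = 2π²`. -/
theorem stmt9 (P : S3) (t : ℝ) (ht : 0 < t) :
    ∫ x, (bubble P t x) ^ 3 ∂μS3 = 2 * π ^ 2 := by
  set h : ℝ → ℝ := fun c ↦ (t / (1 + ((t ^ 2 - 1) / 2) * (1 - c))) ^ 3 with hh
  have hmeas : Measurable h := by fun_prop
  have hnonneg {c : ℝ} (hc : c ∈ Icc (-1) 1) : 0 ≤ h c :=
    pow_nonneg (div_nonneg ht.le (bubble_denom_pos ht hc).le) 3
  have hinner (x : S3) :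
      ⟪(x : EuclideanSpace ℝ (Fin 4)), (P : EuclideanSpace ℝ (Fin 4))⟫ ∈ Icc (-1 : ℝ) 1 := by
    rw [mem_Icc, ← abs_le]
    simpa using abs_real_inner_le_norm (x : EuclideanSpace ℝ (Fin 4)) P
  have hcirc : ∫⁻ θ in Ioo 0 π, ENNReal.ofReal (sin θ ^ 2) * ENNReal.ofReal (h (cos θ)) =
      ENNReal.ofReal (π / 2) := by
    have hnn (θ : ℝ) : 0 ≤ h (cos θ) := hnonneg ⟨neg_one_le_cos θ, cos_le_one θ⟩
    have hcont : Continuous fun θ ↦ sin θ ^ 2 * h (cos θ) := by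
      have (θ : ℝ) : 1 + ((t ^ 2 - 1) / 2) * (1 - cos θ) ≠ 0 :=
        (bubble_denom_pos ht ⟨neg_one_le_cos θ, cos_le_one θ⟩).ne'
      simp only [hh]
      fun_prop (disch := assumption)
    simp_rw [← ENNReal.ofReal_mul (sq_nonneg _)]
    rw [Measure.restrict_congr_set Ioo_ae_eq_Ioc, ← ofReal_integral_eq_lintegral_ofReal
      (hcont.intervalIntegrable 0 π).1 (.of_forall fun θ ↦ mul_nonneg (sq_nonneg _) (hnn θ)),
      ← intervalIntegral.integral_of_le pi_pos.le, integral_sin_sq_mul_bubble_cube ht]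
  change ∫ x : S3, h ⟪(x : EuclideanSpace ℝ (Fin 4)), (P : EuclideanSpace ℝ (Fin 4))⟫ ∂μS3 = _
  rw [integral_eq_lintegral_of_nonneg_ae (.of_forall fun x ↦ hnonneg (hinner x))
      (hmeas.comp (by fun_prop)).aestronglyMeasurable, lintegral_inner_μS3 P (f := fun c ↦ ENNReal.ofReal (h c)) (by fun_prop),
    hcirc, ← ENNReal.ofReal_mul (by positivity), ENNReal.toReal_ofReal (by positivity)]
  ring
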